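/- The theory RKf + Pr4 is inconsistent, where Pr4 is the probabilistic analogue of the modal S4 axiom taken as an axiom schema for all sentences φ of L_Q: Pr(φ, 1) → Pr(Pr(φ, 1), 1). -/

import Mathlib

/-!
Abstract arithmetized syntax for the language `L_Q = L_{Q⁻} ∪ {Pr}` of
Cieśliński–Horsten–Leitgeb, *Axioms for Typefree Subjective Probability*.

`Sen` is the type of (codes of) `L_Q`-sentences.  The fields provide the
arithmetized logical operations on codes (dotted connectives), distinguished
atoms expressing facts about the two-place probability predicate `Pr`
(`Pr(x, y)`, also written `Pr(x) = y`), the collection `Base` of (codes of)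
sentences of the mathematical base language `L_{Q⁻}`, and the axiom set
`QAx` of the background theory `Q`: a standard classical first-order theory
`Q⁻` of the rational numbers, whose language contains a predicate `N` for
the natural numbers and the Peano axioms relativized to `N`, with all
logical and nonlogical schemes extended to the full language `L_Q`.
The `q_*` fields record that `QAx` contains (at least) all axioms of
classical propositional logic for the full language `L_Q`.
-/
structure LQ where
  /-- (codes of) sentences of `L_Q` -/
  Sen : Type
  /-- arithmetized negation -/
  neg : Sen → Sen
  /-- arithmetized conditional -/
  imp : Sen → Sen → Sen
  /-- arithmetized disjunction -/
  orS : Sen → Sen → Sen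
  /-- arithmetized conjunction -/
  andS : Sen → Sen → Sen
  /-- arithmetized biconditional -/
  iffS : Sen → Sen → Sen
  /-- a fixed contradictory sentence `⊥` -/
  bot : Sen
  /-- `prEq φ a` is (the code of) the object sentence `Pr(⌜φ⌝) = a` -/
  prEq : Sen → ℚ → Sen
  /-- `prLtOne φ` is the object sentence `Pr(⌜φ⌝) < 1` -/
  prLtOne : Sen → Sen
  /-- `prGe φ ψ` is the object sentence `Pr(⌜φ⌝) ≥ Pr(⌜ψ⌝)` -/
  prGe : Sen → Sen → Sen
  /-- `prIn φ a b` is the object sentence `Pr(⌜φ⌝) ∈ [a, b]` -/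
  prIn : Sen → ℚ → ℚ → Sen
  /-- (codes of) sentences of the mathematical base language `L_{Q⁻}` -/
  Base : Set Sen
  /-- the axioms of the background theory `Q` -/
  QAx : Set Sen
  q_imp_k : ∀ φ ψ, imp φ (imp ψ φ) ∈ QAx
  q_imp_s : ∀ φ ψ χ, imp (imp φ (imp ψ χ)) (imp (imp φ ψ) (imp φ χ)) ∈ QAx
  q_dne : ∀ φ, imp (neg (neg φ)) φ ∈ QAx
  q_bot : ∀ φ, imp bot φ ∈ QAx
  q_neg_elim : ∀ φ, imp φ (imp (neg φ) bot) ∈ QAx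
  q_neg_intro : ∀ φ, imp (imp φ bot) (neg φ) ∈ QAx
  q_and_intro : ∀ φ ψ, imp φ (imp ψ (andS φ ψ)) ∈ QAx
  q_and_left : ∀ φ ψ, imp (andS φ ψ) φ ∈ QAx
  q_and_right : ∀ φ ψ, imp (andS φ ψ) ψ ∈ QAx
  q_or_inl : ∀ φ ψ, imp φ (orS φ ψ) ∈ QAx
  q_or_inr : ∀ φ ψ, imp ψ (orS φ ψ) ∈ QAx
  q_or_elim : ∀ φ ψ χ, imp (imp φ χ) (imp (imp ψ χ) (imp (orS φ ψ) χ)) ∈ QAx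
  q_iff_intro : ∀ φ ψ, imp (imp φ ψ) (imp (imp ψ φ) (iffS φ ψ)) ∈ QAx
  q_iff_mp : ∀ φ ψ, imp (iffS φ ψ) (imp φ ψ) ∈ QAx
  q_iff_mpr : ∀ φ ψ, imp (iffS φ ψ) (imp ψ φ) ∈ QAx

/-- The axioms of the theory `RKf` ("Reflexive Kolmogorov Finite") of finitely
additive typefree subjective probability.  Object-level universally quantified
axioms are rendered schematically, by the families of all their instances.
The final constructors (`ltOfEq` … `notInOfEq`) record `Q`-provable links
between the probability atoms `prEq`, `prLtOne`, `prGe`, `prIn`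
(consequences of `Q` together with Kf2, Kf3 and Kf7, `Pr` being a total
function on sentences with values in `[0,1]`). -/
inductive KfAx (L : LQ) : L.Sen → Prop
  /-- Kf1: the background theory `Q` -/
  | q {φ} (h : φ ∈ L.QAx) : KfAx L φ
  /-- Kf2: `Pr` is a function -/
  | func (φ : L.Sen) {a b : ℚ} (h : a ≠ b) :
      KfAx L (L.imp (L.prEq φ a) (L.neg (L.prEq φ b)))
  /-- Kf3: `0 ≤ Pr(φ) ≤ 1` -/
  | range (φ : L.Sen) {a : ℚ} (h : ¬ (0 ≤ a ∧ a ≤ 1)) :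
      KfAx L (L.neg (L.prEq φ a))
  /-- Kf4 (constant-term instances): `Pr(φ) = 1 ↔ φ` for `φ ∈ L_{Q⁻}` -/
  | baseRefl {φ} (h : φ ∈ L.Base) : KfAx L (L.iffS (L.prEq φ 1) φ)
  /-- Kf5: `Pr(φ) ≤ Pr(φ ∨ ψ)` -/
  | monoOrLeft (φ ψ : L.Sen) : KfAx L (L.prGe (L.orS φ ψ) φ)
  /-- Kf5: `Pr(ψ) ≤ Pr(φ ∨ ψ)` -/
  | monoOrRight (φ ψ : L.Sen) : KfAx L (L.prGe (L.orS φ ψ) ψ)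
  /-- Kf6: `Pr(φ ∨ ψ) = Pr(φ) + Pr(ψ) − Pr(φ ∧ ψ)` -/
  | add (φ ψ : L.Sen) (a b c : ℚ) :
      KfAx L (L.imp
        (L.andS (L.prEq φ a) (L.andS (L.prEq ψ b) (L.prEq (L.andS φ ψ) c)))
        (L.prEq (L.orS φ ψ) (a + b - c)))
  /-- Kf7: `Pr(¬φ) = 1 − Pr(φ)` -/
  | negPr (φ : L.Sen) (a : ℚ) :
      KfAx L (L.imp (L.prEq φ a) (L.prEq (L.neg φ) (1 - a)))
  /-- Kf7 together with Kf2 (totality/functionality of `Pr`) -/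
  | negPr' (φ : L.Sen) (a : ℚ) :
      KfAx L (L.imp (L.prEq (L.neg φ) a) (L.prEq φ (1 - a)))
  | ltOfEq (φ : L.Sen) {a : ℚ} (h : a < 1) :
      KfAx L (L.imp (L.prEq φ a) (L.prLtOne φ))
  | notEqOfLt (φ : L.Sen) : KfAx L (L.imp (L.prLtOne φ) (L.neg (L.prEq φ 1)))
  | ltOfNotEq (φ : L.Sen) : KfAx L (L.imp (L.neg (L.prEq φ 1)) (L.prLtOne φ))
  | geOfEq (φ ψ : L.Sen) {a b : ℚ} (h : b ≤ a) :
      KfAx L (L.imp (L.andS (L.prEq φ a) (L.prEq ψ b)) (L.prGe φ ψ))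
  | eqOneOfGe (φ ψ : L.Sen) :
      KfAx L (L.imp (L.andS (L.prGe φ ψ) (L.prEq ψ 1)) (L.prEq φ 1))
  | inOfEq (φ : L.Sen) {a b c : ℚ} (h1 : a ≤ c) (h2 : c ≤ b) :
      KfAx L (L.imp (L.prEq φ c) (L.prIn φ a b))
  | notInOfEq (φ : L.Sen) {a b c : ℚ} (h : ¬ (a ≤ c ∧ c ≤ b)) :
      KfAx L (L.imp (L.prEq φ c) (L.neg (L.prIn φ a b)))

/-- Provability, in classical logic, from the axiom set `Ax` (which is
intended to contain the axioms of `Q`, in particular all logical axioms),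
closed under modus ponens and under the necessitation rule Kf8:
from a proof of `φ`, infer `Pr(φ) = 1`. -/
inductive Thm (L : LQ) (Ax : L.Sen → Prop) : L.Sen → Prop
  | ax {φ} (h : Ax φ) : Thm L Ax φ
  | mp {φ ψ} (h1 : Thm L Ax (L.imp φ ψ)) (h2 : Thm L Ax φ) : Thm L Ax ψ
  /-- Kf8 (necessitation) -/
  | nec {φ} (h : Thm L Ax φ) : Thm L Ax (L.prEq φ 1)

/-- The instances of the probabilistic analogue `Pr4` of the modal S4 axiom,
taken as an axiom schema for all sentences `φ` of `L_Q`: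
`Pr(φ, 1) → Pr(Pr(φ, 1), 1)`. -/
def Pr4Ax (L : LQ) (χ : L.Sen) : Prop :=
  ∃ φ : L.Sen, χ = L.imp (L.prEq φ 1) (L.prEq (L.prEq φ 1) 1)

section PropositionalReasoning

variable {L : LQ} {Ax : L.Sen → Prop}

/-- Modus ponens under a common antecedent. -/
theorem Thm.mp_under {γ φ ψ : L.Sen} (hQ : ∀ χ ∈ L.QAx, Ax χ)
    (h₁ : Thm L Ax (L.imp γ (L.imp φ ψ))) (h₂ : Thm L Ax (L.imp γ φ)) :
    Thm L Ax (L.imp γ ψ) :=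
  .mp (.mp (.ax (hQ _ (L.q_imp_s γ φ ψ))) h₁) h₂

theorem Thm.weaken {φ : L.Sen} (γ : L.Sen) (hQ : ∀ χ ∈ L.QAx, Ax χ) (h : Thm L Ax φ) :
    Thm L Ax (L.imp γ φ) :=
  .mp (.ax (hQ _ (L.q_imp_k φ γ))) h

theorem Thm.imp_trans {φ ψ χ : L.Sen} (hQ : ∀ χ ∈ L.QAx, Ax χ)
    (h₁ : Thm L Ax (L.imp φ ψ)) (h₂ : Thm L Ax (L.imp ψ χ)) :
    Thm L Ax (L.imp φ χ) :=
  .mp_under hQ (.weaken φ hQ h₂) h₁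

theorem Thm.imp_refl (φ : L.Sen) (hQ : ∀ χ ∈ L.QAx, Ax χ) : Thm L Ax (L.imp φ φ) :=
  .mp_under hQ (.ax (hQ _ (L.q_imp_k φ (L.imp φ φ)))) (.ax (hQ _ (L.q_imp_k φ φ)))

theorem Thm.and_intro_under {γ φ ψ : L.Sen} (hQ : ∀ χ ∈ L.QAx, Ax χ)
    (h₁ : Thm L Ax (L.imp γ φ)) (h₂ : Thm L Ax (L.imp γ ψ)) :
    Thm L Ax (L.imp γ (L.andS φ ψ)) :=
  .mp_under hQ (.imp_trans hQ h₁ (.ax (hQ _ (L.q_and_intro φ ψ)))) h₂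

/-- Reductio: a sentence implying both `φ` and `¬φ` is refutable. -/
theorem Thm.neg_of_imp_of_imp_neg {γ φ : L.Sen} (hQ : ∀ χ ∈ L.QAx, Ax χ)
    (h₁ : Thm L Ax (L.imp γ φ)) (h₂ : Thm L Ax (L.imp γ (L.neg φ))) :
    Thm L Ax (L.neg γ) :=
  .mp (.ax (hQ _ (L.q_neg_intro γ)))
    (.mp_under hQ (.imp_trans hQ h₁ (.ax (hQ _ (L.q_neg_elim φ)))) h₂)

end PropositionalReasoning

/-- Two sentences with refutable conjunction cannot both have probability `1`. -/
theorem Thm.neg_of_imp_prob_one {L : LQ} {Ax : L.Sen → Prop} (hKf : ∀ χ, KfAx L χ → Ax χ)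
    {γ φ ψ : L.Sen} (hφψ : Thm L Ax (L.neg (L.andS φ ψ)))
    (hφ : Thm L Ax (L.imp γ (L.prEq φ 1))) (hψ : Thm L Ax (L.imp γ (L.prEq ψ 1))) :
    Thm L Ax (L.neg γ) := by
  have hQ : ∀ χ ∈ L.QAx, Ax χ := fun χ h => hKf χ (.q h)
  have hand : Thm L Ax (L.prEq (L.andS φ ψ) (1 - 1)) :=
    .mp (.ax (hKf _ (.negPr' _ _))) (.nec hφψ)
  have hor : Thm L Ax (L.imp γ (L.prEq (L.orS φ ψ) (1 + 1 - (1 - 1)))) :=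
    .imp_trans hQ
      (.and_intro_under hQ hφ (.and_intro_under hQ hψ (.weaken γ hQ hand)))
      (.ax (hKf _ (.add _ _ _ _ _)))
  exact .neg_of_imp_of_imp_neg hQ hor
    (.weaken γ hQ (.ax (hKf _ (.range _ (by norm_num)))))

/-- Proposition 3.  The theory `RKf + Pr4` is inconsistent.
Since `Pr4` is added as an axiom, the necessitation rule Kf8 applies to all
theorems of the extended theory (this is built into `Thm`).  The hypothesis
`diag` is the instance of the diagonal lemma providing a probabilistic liar
sentence `λ` with `⊢ λ ↔ ¬ Pr(λ, 1)`. -/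
theorem RKf_Pr4_inconsistent (L : LQ)
    (diag : ∃ lam : L.Sen,
      Thm L (fun χ => KfAx L χ ∨ Pr4Ax L χ)
        (L.iffS lam (L.neg (L.prEq lam 1)))) :
    Thm L (fun χ => KfAx L χ ∨ Pr4Ax L χ) L.bot := by
  obtain ⟨lam, hlam⟩ := diag
  set Ax : L.Sen → Prop := fun χ => KfAx L χ ∨ Pr4Ax L χ
  have hKf : ∀ χ, KfAx L χ → Ax χ := fun _ h => Or.inl h
  have hQ : ∀ χ ∈ L.QAx, Ax χ := fun χ h => hKf χ (.q h)
  have hconj : Thm L Ax (L.neg (L.andS (L.prEq lam 1) lam)) :=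
    .neg_of_imp_of_imp_neg hQ (.ax (hQ _ (L.q_and_left _ _)))
      (.imp_trans hQ (.ax (hQ _ (L.q_and_right _ _)))
        (.mp (.ax (hQ _ (L.q_iff_mp _ _))) hlam))
  have hneg : Thm L Ax (L.neg (L.prEq lam 1)) :=
    .neg_of_imp_prob_one hKf hconj (.ax (Or.inr ⟨lam, rfl⟩)) (.imp_refl _ hQ)
  have hpr : Thm L Ax (L.prEq lam 1) :=
    .nec (.mp (.mp (.ax (hQ _ (L.q_iff_mpr _ _))) hlam) hneg)
  exact .mp (.mp (.ax (hQ _ (L.q_neg_elim _))) hpr) hneg
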